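/- Let b, c, d, e, g be real (or complex) parameters with e and g not nonpositive integers, and let z(x,y) = F^{0;2;1}_{1;0;1}[-: b,c; d; e: -; g; x,y]. Then on the domain |x| < 1 (all y), z satisfies the partial differential equation x(1-x) z_xx + y z_xy + [e - (b+c+1)x] z_x - b c z = 0. -/

import Mathlib

noncomputable section

/-- The Pochhammer symbol `(a)_k = a (a+1) ⋯ (a+k-1)`. -/
def poch (a : ℝ) (k : ℕ) : ℝ := ∏ i ∈ Finset.range k, (a + i)
/-- The degenerate hypergeometric function of two variables of the third order
`F^{0;2;1}_{1;0;1}[-: b,c; d; e: -; g; x,y]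
  = ∑_{m,n≥0} (b)_m (c)_m (d)_n / ((e)_{m+n} (g)_n m! n!) x^m y^n`. -/
def F021 (b c d e g x y : ℝ) : ℝ :=
  ∑' mn : ℕ × ℕ,
    poch b mn.1 * poch c mn.1 * poch d mn.2 /
      (poch e (mn.1 + mn.2) * poch g mn.2 * mn.1.factorial * mn.2.factorial) *
      x ^ mn.1 * y ^ mn.2

theorem poch_succ' (a : ℝ) (k : ℕ) : poch a (k+1) = poch a k * (a + k) := by
  simp [poch, Finset.prod_range_succ]

theorem poch_ne (e : ℝ) (he : ∀ k : ℕ, e ≠ -(k : ℝ)) (k : ℕ) : poch e k ≠ 0 := by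
  unfold poch
  refine Finset.prod_ne_zero_iff.2 fun i _ h => he i (by linarith)

theorem ratio_summable (f q : ℕ → ℝ) (L : ℝ) (hL : |L| < 1) (h : ∀ m, f (m+1) = q m * f m)
    (hq : Filter.Tendsto q Filter.atTop (nhds L)) : Summable f := by
  obtain ⟨r, h1, h2⟩ := exists_between hL
  refine summable_of_ratio_norm_eventually_le (r := r) h2 ?_
  filter_upwards [hq.abs.eventually (gt_mem_nhds h1)] with n hn
  rw [h, norm_mul, Real.norm_eq_abs, Real.norm_eq_abs]
  gcongr

theorem tend1 (a b : ℝ) :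
    Filter.Tendsto (fun m : ℕ => (a + m) / (b + m)) Filter.atTop (nhds 1) := by
  simpa using tendsto_add_mul_div_add_mul_atTop_nhds a b (1:ℝ) (d := 1) one_ne_zero

theorem sumA (b c e r : ℝ) (he : ∀ k : ℕ, e ≠ -(k : ℝ)) (h0 : 0 < r) (h1 : r < 1) :
    Summable fun m : ℕ => ((m:ℝ)+1)^2 * (poch b m * poch c m / (poch e m * m.factorial)) * r ^ m := by
  refine ratio_summable _ (fun m : ℕ => ((2 + m) / (1 + m)) * ((2 + m) / (1 + m)) *
    ((b + m) / (e + m)) * ((c + m) / (1 + m)) * r) (1*1*1*1*r) (by simpa [abs_of_pos h0] using h1) ?_ ?_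
  · intro m
    have h2 : e + m ≠ 0 := fun h => he m (by linarith)
    have h3 := poch_ne e he m
    have h4 : (1:ℝ) + m ≠ 0 := by positivity
    have h6 : (m:ℝ) + 1 ≠ 0 := by positivity
    have h5 : (m.factorial : ℝ) ≠ 0 := by positivity
    simp only [poch_succ', Nat.factorial_succ, pow_succ]
    push_cast
    field_simp
    ring
  · exact ((((tend1 _ _).mul (tend1 _ _)).mul (tend1 _ _)).mul (tend1 _ _)).mul_const _

theorem sumB (d g s : ℝ) (hg : ∀ k : ℕ, g ≠ -(k : ℝ)) :
    Summable fun n : ℕ => ((n:ℝ)+1) * (poch d n / (poch g n * n.factorial)) * s ^ n := by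
  refine ratio_summable _ (fun m : ℕ => ((2 + m) / (1 + m)) *
    ((d + m) / (g + m)) * (s * (1 / ((m:ℝ) + 1)))) (1*1*(s*0)) (by simp) ?_ ?_
  · intro m
    have h2 : g + m ≠ 0 := fun h => hg m (by linarith)
    have h3 := poch_ne g hg m
    have h4 : (1:ℝ) + m ≠ 0 := by positivity
    have h6 : (m:ℝ) + 1 ≠ 0 := by positivity
    have h5 : (m.factorial : ℝ) ≠ 0 := by positivity
    simp only [poch_succ', Nat.factorial_succ, pow_succ]
    push_cast
    field_simp
    ring
  · exact ((tend1 _ _).mul (tend1 _ _)).mul (tendsto_one_div_add_atTop_nhds_zero_nat.const_mul s)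

theorem poch_lower (e : ℝ) (he : ∀ k : ℕ, e ≠ -(k : ℝ)) :
    ∃ δ : ℝ, 0 < δ ∧ ∀ m n, δ * |poch e m| ≤ |poch e (m+n)| := by
  obtain ⟨N, hN⟩ := exists_nat_ge (1 - e)
  have hpos : ∀ i : ℕ, 0 < min 1 |e + i| := fun i =>
    lt_min one_pos (abs_pos.2 fun h => he i (by linarith))
  let P : ℕ → ℝ := fun k => ∏ i ∈ Finset.range k, min 1 |e + i|
  have hP : ∀ k, 0 < P k := fun k => Finset.prod_pos fun i _ => hpos i
  have hP1 : ∀ k, P (k+1) = P k * min 1 |e + k| := fun k => by simp [P, Finset.prod_range_succ]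
  have hPN : ∀ k, P N ≤ P k := by
    intro k
    rcases le_total k N with h | h
    · exact antitone_nat_of_succ_le (f := P) (fun k => by
        rw [hP1]; exact mul_le_of_le_one_right (hP k).le (min_le_left _ _)) h
    · induction k, h using Nat.le_induction with
      | base => rfl
      | succ k hk ih =>
        rw [hP1, min_eq_left, mul_one]; exact ih
        have : (N:ℝ) ≤ k := by exact_mod_cast hk
        exact le_trans (by linarith) (le_abs_self _)
  have key : ∀ m n, P (m+n) * |poch e m| ≤ |poch e (m+n)| := by
    intro m n
    induction n with
    | zero =>
      refine mul_le_of_le_one_left (abs_nonneg _) ?_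
      exact Finset.prod_le_one (fun i _ => (hpos i).le) (fun i _ => min_le_left _ _)
    | succ n ih =>
      rw [← add_assoc, hP1, poch_succ', abs_mul, mul_right_comm]
      exact mul_le_mul ih (min_le_right _ _) (hpos _).le (abs_nonneg _)
  exact ⟨P N, hP N, fun m n =>
    (mul_le_mul_of_nonneg_right (hPN _) (abs_nonneg _)).trans (key m n)⟩

def cf (b c d e g : ℝ) (mn : ℕ × ℕ) : ℝ :=
  poch b mn.1 * poch c mn.1 * poch d mn.2 /
      (poch e (mn.1 + mn.2) * poch g mn.2 * mn.1.factorial * mn.2.factorial)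

def wt (b c d e g r s : ℝ) (p : ℕ × ℕ) : ℝ :=
  |cf b c d e g p| * (((p.1:ℝ)+1)^2 * ((p.2:ℝ)+1) * (r ^ p.1 * s ^ p.2))

theorem wt_summable (b c d e g r s : ℝ)
    (he : ∀ k : ℕ, e ≠ -(k : ℝ)) (hg : ∀ k : ℕ, g ≠ -(k : ℝ))
    (h0 : 0 < r) (h1 : r < 1) (hs : 0 < s) : Summable (wt b c d e g r s) := by
  obtain ⟨δ, hδ, hl⟩ := poch_lower e he
  have hA := (sumA b c e r he h0 h1).abs
  have hB := (sumB d g s hg).abs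
  have := (hA.mul_of_nonneg hB (fun _ => abs_nonneg _) (fun _ => abs_nonneg _)).mul_left δ⁻¹
  refine Summable.of_nonneg_of_le (fun p => by unfold wt; positivity) ?_ this
  rintro ⟨m, n⟩
  have e1 := abs_pos.2 (poch_ne e he m)
  have e2 := abs_pos.2 (poch_ne e he (m+n))
  have e3 := abs_pos.2 (poch_ne g hg n)
  have hm : (0:ℝ) < m.factorial := by positivity
  have hn : (0:ℝ) < n.factorial := by positivity
  have hinv : |poch e (m+n)|⁻¹ ≤ δ⁻¹ * |poch e m|⁻¹ := by
    rw [← mul_inv]; exact inv_anti₀ (by positivity) (hl m n)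
  have a1 : |(m:ℝ)+1| = m + 1 := abs_of_pos (by positivity)
  have a2 : |(n:ℝ)+1| = n + 1 := abs_of_pos (by positivity)
  simp only [wt, cf, abs_mul, abs_div, abs_pow, Nat.abs_cast, abs_of_pos h0, abs_of_pos hs, a1, a2]
  calc _ = |poch e (m+n)|⁻¹ * (|poch b m| * |poch c m| * |poch d n| * |poch g n|⁻¹ * (m.factorial:ℝ)⁻¹
        * (n.factorial:ℝ)⁻¹ * (((m:ℝ)+1)^2 * ((n:ℝ)+1) * (r ^ m * s ^ n))) := by
        field_simp
    _ ≤ (δ⁻¹ * |poch e m|⁻¹) * (|poch b m| * |poch c m| * |poch d n| * |poch g n|⁻¹ * (m.factorial:ℝ)⁻¹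
        * (n.factorial:ℝ)⁻¹ * (((m:ℝ)+1)^2 * ((n:ℝ)+1) * (r ^ m * s ^ n))) := by
        gcongr
    _ = _ := by field_simp

theorem deriv_gen {ι : Type*} (f : ι → ℝ) (k : ι → ℕ) (r x : ℝ) (hx : |x| < r)
    (h0 : Summable fun i => f i * x ^ k i)
    (h : Summable fun i => |f i| * (k i * r ^ (k i - 1))) :
    HasDerivAt (fun x => ∑' i, f i * x ^ k i) (∑' i, f i * (k i * x ^ (k i - 1))) x := by
  have hxb : x ∈ Metric.ball (0:ℝ) r := by simpa using hx
  refine hasDerivAt_tsum_of_isPreconnected (t := Metric.ball 0 r) h Metric.isOpen_ball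
    (convex_ball (0:ℝ) r).isPreconnected (g := fun i x => f i * x ^ k i)
    (g' := fun i x => f i * (k i * x ^ (k i - 1))) ?_ ?_ hxb h0 hxb
  · intro i y _
    exact (hasDerivAt_pow (k i) y).const_mul (f i)
  · intro i y hy
    have : |y| ≤ r := by simpa using (Metric.mem_ball.1 hy).le
    rw [Real.norm_eq_abs, abs_mul, abs_mul, abs_pow, Nat.abs_cast]
    gcongr

theorem pow_pred_le {r : ℝ} (h0 : 0 < r) (h1 : r ≤ 1) (m : ℕ) : r ^ (m-1) ≤ r⁻¹ * r ^ m := by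
  cases m with
  | zero => simpa using (one_le_inv₀ h0).2 h1
  | succ m => simp only [Nat.add_sub_cancel, pow_succ]; field_simp; rfl

theorem xb {r x : ℝ} (h0 : 0 < r) (h1 : r ≤ 1) (hx : |x| ≤ r) (m : ℕ) :
    |x ^ m| ≤ r⁻¹ * r⁻¹ * r ^ m ∧ |x ^ (m-1)| ≤ r⁻¹ * r⁻¹ * r ^ m ∧
    |x ^ (m-1-1)| ≤ r⁻¹ * r⁻¹ * r ^ m := by
  have hr : 1 ≤ r⁻¹ := (one_le_inv₀ h0).2 h1
  have hk : ∀ k, |x ^ k| ≤ r ^ k := fun k => by rw [abs_pow]; gcongr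
  have p0 : 0 ≤ r ^ m := by positivity
  have e1 := pow_pred_le h0 h1 m
  have e2 := pow_pred_le h0 h1 (m-1)
  have p1 : 0 ≤ r⁻¹ * r ^ m := by positivity
  have e3 : r⁻¹ * r ^ m ≤ r⁻¹ * (r⁻¹ * r ^ m) := by
    gcongr; nlinarith
  have e4 : r⁻¹ * r ^ (m-1) ≤ r⁻¹ * (r⁻¹ * r ^ m) := by gcongr
  have e5 : r ^ m ≤ r⁻¹ * r ^ m := by nlinarith
  rw [mul_assoc]
  exact ⟨by linarith [hk m], by linarith [hk (m-1)], by linarith [hk (m-1-1)]⟩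

theorem yb {s y : ℝ} (h1 : 1 ≤ s) (hy : |y| ≤ s) (n : ℕ) :
    |y ^ n| ≤ s ^ n ∧ |y ^ (n-1)| ≤ s ^ n := by
  have hk : ∀ k, |y ^ k| ≤ s ^ k := fun k => by rw [abs_pow]; gcongr
  exact ⟨hk n, (hk _).trans (pow_le_pow_right₀ h1 (Nat.sub_le _ _))⟩

theorem gen_summ (b c d e g r s : ℝ)
    (he : ∀ k : ℕ, e ≠ -(k : ℝ)) (hg : ∀ k : ℕ, g ≠ -(k : ℝ))
    (h0 : 0 < r) (h1 : r < 1) (hs : 1 ≤ s) (P X Y : ℕ × ℕ → ℝ)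
    (hP : ∀ p, |P p| ≤ ((p.1:ℝ)+1)^2 * ((p.2:ℝ)+1))
    (hX : ∀ p, |X p| ≤ r⁻¹ * r⁻¹ * r ^ p.1) (hY : ∀ p, |Y p| ≤ s ^ p.2) :
    Summable fun p => cf b c d e g p * (P p * X p * Y p) := by
  refine Summable.of_norm_bounded
    ((wt_summable b c d e g r s he hg h0 h1 (by linarith)).mul_left (r⁻¹ * r⁻¹)) fun p => ?_
  rw [Real.norm_eq_abs, abs_mul, abs_mul, abs_mul]
  calc _ ≤ |cf b c d e g p| * ((((p.1:ℝ)+1)^2 * ((p.2:ℝ)+1)) * (r⁻¹ * r⁻¹ * r ^ p.1) * s ^ p.2) := by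
        gcongr
        · exact hP p
        · exact hX p
        · exact hY p
    _ = _ := by unfold wt; ring

theorem pb (p : ℕ × ℕ) : |(1:ℝ)| ≤ ((p.1:ℝ)+1)^2 * ((p.2:ℝ)+1) ∧
    |(p.1:ℝ)| ≤ ((p.1:ℝ)+1)^2 * ((p.2:ℝ)+1) ∧
    |(p.1:ℝ) * ((p.1 - 1 : ℕ) : ℝ)| ≤ ((p.1:ℝ)+1)^2 * ((p.2:ℝ)+1) ∧
    |(p.1:ℝ) * (p.2 : ℝ)| ≤ ((p.1:ℝ)+1)^2 * ((p.2:ℝ)+1) := by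
  have hm : (0:ℝ) ≤ p.1 := by positivity
  have hn : (0:ℝ) ≤ p.2 := by positivity
  have hk : ((p.1 - 1 : ℕ) : ℝ) ≤ p.1 := by exact_mod_cast Nat.sub_le _ _
  have hk0 : (0:ℝ) ≤ ((p.1 - 1 : ℕ) : ℝ) := by positivity
  have hmn := mul_nonneg hm hn
  have hmm := mul_nonneg hm hm
  have hmmn := mul_nonneg hmm hn
  have := mul_le_mul_of_nonneg_left hk hm
  rw [abs_of_pos one_pos, abs_of_nonneg hm, abs_of_nonneg (mul_nonneg hm hk0), abs_of_nonneg hmn]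
  refine ⟨?_, ?_, ?_, ?_⟩ <;> nlinarith

/-- general monomial-weighted sum -/
theorem main_aux (b c d e g : ℝ)
    (he : ∀ k : ℕ, e ≠ -(k : ℝ)) (hg : ∀ k : ℕ, g ≠ -(k : ℝ))
    (x y : ℝ) (hx : |x| < 1) :
    HasDerivAt (fun x' => F021 b c d e g x' y)
      (∑' p : ℕ × ℕ, cf b c d e g p * ((p.1:ℝ) * x ^ (p.1 - 1) * y ^ p.2)) x ∧
    HasDerivAt (fun x => ∑' p : ℕ × ℕ, cf b c d e g p * ((p.1:ℝ) * x ^ (p.1 - 1) * y ^ p.2))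
      (∑' p : ℕ × ℕ, cf b c d e g p *
        ((p.1:ℝ) * ((p.1 - 1 : ℕ):ℝ) * x ^ (p.1 - 1 - 1) * y ^ p.2)) x ∧
    HasDerivAt (fun y => ∑' p : ℕ × ℕ, cf b c d e g p * ((p.1:ℝ) * x ^ (p.1 - 1) * y ^ p.2))
      (∑' p : ℕ × ℕ, cf b c d e g p *
        ((p.1:ℝ) * (p.2:ℝ) * x ^ (p.1 - 1) * y ^ (p.2 - 1))) y := by
  obtain ⟨r, hr, h1⟩ := exists_between hx
  have h0 : 0 < r := (abs_nonneg x).trans_lt hr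
  have hs : 1 ≤ |y| + 1 := by linarith [abs_nonneg y]
  have hys : |y| < |y| + 1 := by linarith
  have G := gen_summ b c d e g r (|y|+1) he hg h0 h1 hs
  have X := fun p : ℕ × ℕ => xb h0 h1.le hr.le p.1
  have R := fun p : ℕ × ℕ => xb h0 h1.le (abs_of_pos h0).le p.1
  have Y := fun p : ℕ × ℕ => yb hs hys.le p.2
  have S := fun p : ℕ × ℕ => yb hs (abs_of_pos (by linarith : 0 < |y|+1)).le p.2
  refine ⟨?_, ?_, ?_⟩
  · have := deriv_gen (fun p : ℕ × ℕ => cf b c d e g p * y ^ p.2) (fun p => p.1) r x hr ?_ ?_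
    · convert this using 1
      · funext x'
        unfold F021
        exact tsum_congr fun p => by unfold cf; ring
      · exact tsum_congr fun p => by ring
    · exact (G _ _ _ (fun p => (pb p).1) (fun p => (X p).1) (fun p => (Y p).1)).congr
        fun p => by ring
    · refine (G _ _ _ (fun p => (pb p).2.1) (fun p => (R p).2.1) (fun p => (Y p).1)).abs.congr
        fun p => ?_
      simp only [abs_mul, abs_pow, Nat.abs_cast, abs_of_pos h0]; ring
  · have := deriv_gen (fun p : ℕ × ℕ => cf b c d e g p * p.1 * y ^ p.2) (fun p => p.1 - 1) r x hr ?_ ?_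
    · convert this using 1
      · funext x'
        exact tsum_congr fun p => by ring
      · exact tsum_congr fun p => by ring
    · exact (G _ _ _ (fun p => (pb p).2.1) (fun p => (X p).2.1) (fun p => (Y p).1)).congr
        fun p => by ring
    · refine (G _ _ _ (fun p => (pb p).2.2.1) (fun p => (R p).2.2) (fun p => (Y p).1)).abs.congr
        fun p => ?_
      simp only [abs_mul, abs_pow, Nat.abs_cast, abs_of_pos h0]; ring
  · have := deriv_gen (fun p : ℕ × ℕ => cf b c d e g p * p.1 * x ^ (p.1 - 1)) (fun p => p.2)
      (|y|+1) y hys ?_ ?_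
    · convert this using 1
      · funext x'
        exact tsum_congr fun p => by ring
      · exact tsum_congr fun p => by ring
    · exact (G _ _ _ (fun p => (pb p).2.1) (fun p => (X p).2.1) (fun p => (Y p).1)).congr
        fun p => by ring
    · refine (G _ _ _ (fun p => (pb p).2.2.2) (fun p => (X p).2.1) (fun p => (S p).2)).abs.congr
        fun p => ?_
      have : |(|y|+1)| = |y| + 1 := abs_of_pos (by linarith)
      simp only [abs_mul, abs_pow, Nat.abs_cast, this]; ring

theorem cf_rec (b c d e g : ℝ)
    (he : ∀ k : ℕ, e ≠ -(k : ℝ)) (hg : ∀ k : ℕ, g ≠ -(k : ℝ)) (m n : ℕ) :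
    cf b c d e g (m+1, n) * (((m:ℝ)+1) * (m + n + e)) =
      cf b c d e g (m, n) * ((b + m) * (c + m)) := by
  have h1 : e + ((m + n : ℕ) : ℝ) ≠ 0 := fun h => he (m+n) (by linarith)
  have h2 := poch_ne e he (m+n)
  have h3 := poch_ne g hg n
  have h5 : (m.factorial : ℝ) ≠ 0 := by positivity
  have h6 : (n.factorial : ℝ) ≠ 0 := by positivity
  have h7 : (m:ℝ) + 1 ≠ 0 := by positivity
  simp only [cf, show m + 1 + n = m + n + 1 by ring, poch_succ', Nat.factorial_succ]
  push_cast at h1 ⊢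
  field_simp
  ring

theorem pred_id (m : ℕ) (x : ℝ) :
    (m:ℝ) * ((m - 1 : ℕ):ℝ) * x ^ (m - 1 - 1) * x = (m:ℝ) * ((m:ℝ) - 1) * x ^ (m-1) ∧
    (m:ℝ) * x ^ (m-1) * x = m * x ^ m := by
  constructor
  · rcases m with _ | _ | m
    · simp
    · simp
    · simp only [Nat.add_sub_cancel]; push_cast; ring
  · rcases m with _ | m
    · simp
    · simp only [Nat.add_sub_cancel]; push_cast; ring

/-- The function `z(x,y) = F^{0;2;1}_{1;0;1}[-: b,c; d; e: -; g; x,y]` satisfies, for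
`|x| < 1` and all `y`, `x(1-x) z_xx + y z_xy + [e - (b+c+1)x] z_x - bc z = 0`. -/
theorem F021_pde_first (b c d e g : ℝ)
    (he : ∀ k : ℕ, e ≠ -(k : ℝ)) (hg : ∀ k : ℕ, g ≠ -(k : ℝ))
    (x y : ℝ) (hx : |x| < 1) :
    x * (1 - x) * deriv (deriv (fun x' : ℝ => F021 b c d e g x' y)) x +
      y * deriv (fun y' : ℝ => deriv (fun x' : ℝ => F021 b c d e g x' y') x) y +
      (e - (b + c + 1) * x) * deriv (fun x' : ℝ => F021 b c d e g x' y) x -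
      b * c * F021 b c d e g x y = 0 := by
  have hD : ∀ x' y', |x'| < 1 → deriv (fun x' : ℝ => F021 b c d e g x' y') x' =
      ∑' p : ℕ × ℕ, cf b c d e g p * ((p.1:ℝ) * x' ^ (p.1 - 1) * y' ^ p.2) :=
    fun x' y' h => (main_aux b c d e g he hg x' y' h).1.deriv
  have hxx : deriv (deriv (fun x' : ℝ => F021 b c d e g x' y)) x =
      ∑' p : ℕ × ℕ, cf b c d e g p *
        ((p.1:ℝ) * ((p.1 - 1 : ℕ):ℝ) * x ^ (p.1 - 1 - 1) * y ^ p.2) := by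
    have : deriv (fun x' : ℝ => F021 b c d e g x' y) =ᶠ[nhds x]
        fun x' => ∑' p : ℕ × ℕ, cf b c d e g p * ((p.1:ℝ) * x' ^ (p.1 - 1) * y ^ p.2) := by
      filter_upwards [(continuous_abs.tendsto x).eventually (gt_mem_nhds hx)] with x' hx'
      exact hD x' y hx'
    rw [this.deriv_eq]
    exact (main_aux b c d e g he hg x y hx).2.1.deriv
  have hxy : deriv (fun y' : ℝ => deriv (fun x' : ℝ => F021 b c d e g x' y') x) y =
      ∑' p : ℕ × ℕ, cf b c d e g p *
        ((p.1:ℝ) * (p.2:ℝ) * x ^ (p.1 - 1) * y ^ (p.2 - 1)) := by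
    rw [show (fun y' : ℝ => deriv (fun x' : ℝ => F021 b c d e g x' y') x) = _ from
      funext fun y' => hD x y' hx]
    exact (main_aux b c d e g he hg x y hx).2.2.deriv
  have hF : F021 b c d e g x y = ∑' p : ℕ × ℕ, cf b c d e g p * (1 * x ^ p.1 * y ^ p.2) :=
    tsum_congr fun p => by unfold cf; ring
  rw [hxx, hxy, hD x y hx, hF]
  obtain ⟨r, hr, h1⟩ := exists_between hx
  have h0 : 0 < r := (abs_nonneg x).trans_lt hr
  have hs : 1 ≤ |y| + 1 := by linarith [abs_nonneg y]
  have hys : |y| < |y| + 1 := by linarith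
  have G := gen_summ b c d e g r (|y|+1) he hg h0 h1 hs
  have X := fun p : ℕ × ℕ => xb h0 h1.le hr.le p.1
  have Y := fun p : ℕ × ℕ => yb hs hys.le p.2
  have s0 := G _ _ _ (fun p => (pb p).1) (fun p => (X p).1) (fun p => (Y p).1)
  have s1 := G _ _ _ (fun p => (pb p).2.1) (fun p => (X p).2.1) (fun p => (Y p).1)
  have s2 := G _ _ _ (fun p => (pb p).2.2.1) (fun p => (X p).2.2) (fun p => (Y p).1)
  have s3 := G _ _ _ (fun p => (pb p).2.2.2) (fun p => (X p).2.1) (fun p => (Y p).2)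
  have H := (((s2.hasSum.mul_left (x * (1 - x))).add (s3.hasSum.mul_left y)).add
    (s1.hasSum.mul_left (e - (b + c + 1) * x))).sub (s0.hasSum.mul_left (b * c))
  -- first part U, second part V
  let U : ℕ × ℕ → ℝ := fun p => cf b c d e g p *
    ((p.1:ℝ) * ((p.1:ℝ) - 1 + p.2 + e) * x ^ (p.1 - 1) * y ^ p.2)
  let V : ℕ × ℕ → ℝ := fun p => cf b c d e g p * ((b + p.1) * (c + p.1) * x ^ p.1 * y ^ p.2)
  have hy1 : ∀ n : ℕ, (n:ℝ) * y ^ (n-1) * y = n * y ^ n := fun n => (pred_id n y).2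
  have hUV : ∀ m n, U (m+1, n) = V (m, n) := by
    intro m n
    have := cf_rec b c d e g he hg m n
    simp only [U, V, Nat.add_sub_cancel]
    push_cast
    linear_combination (x ^ m * y ^ n) * this
  have sU : Summable U := by
    have := ((s2.mul_left x).add (s3.mul_left y)).add (s1.mul_left e)
    refine this.congr fun p => ?_
    have i1 := (pred_id p.1 x).1
    have i3 := hy1 p.2
    simp only [U]
    linear_combination cf b c d e g p * y ^ p.2 * i1 + cf b c d e g p * p.1 * x ^ (p.1-1) * i3
  have inj : Function.Injective (fun p : ℕ × ℕ => (p.1 + 1, p.2)) := by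
    rintro ⟨a, b⟩ ⟨c, d⟩ h
    simpa using h
  have tUV : ∑' p, V p = ∑' p, U p := by
    rw [← inj.tsum_eq (f := U)]
    · exact tsum_congr fun p => (hUV p.1 p.2).symm
    · rintro ⟨m, n⟩ hp
      rcases m with _ | m
      · simp [U] at hp
      · exact ⟨(m, n), rfl⟩
  have sV : Summable V := (sU.comp_injective inj).congr fun p => hUV p.1 p.2
  have K := sU.hasSum.sub sV.hasSum
  rw [tUV, sub_self] at K
  refine H.unique ?_
  convert K using 2 with p
  have i1 := (pred_id p.1 x).1
  have i2 := (pred_id p.1 x).2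
  have i3 := hy1 p.2
  simp only [U, V]
  linear_combination cf b c d e g p * y ^ p.2 * (1 - x) * i1 +
    cf b c d e g p * p.1 * x ^ (p.1-1) * i3 - cf b c d e g p * y ^ p.2 * (p.1 - 1 + b + c + 1) * i2

end
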